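/- Let σ ∈ ℝ and suppose |X^L(t)| ≤ M₀ e^{-αt} for all t ≥ 0 for some M₀ ≥ 1 and α > 0. Let U₀ be an open neighborhood of 0 in C([-r,0],ℝⁿ) and h : ℝ × U₀ → ℝⁿ a continuous map such that for every ε > 0 there is δ > 0 with |h(t,φ)| ≤ ε ‖φ‖ whenever (t,φ) ∈ ℝ × U₀ and ‖φ‖ < δ. Let N : ℝ → B(C([-r,0],ℝⁿ), ℝⁿ) be continuous in the operator norm with ‖N(t)‖ → 0 as t → ∞. Then there exist M ≥ 1, β > 0, and ρ > 0 such that for every t₀ ≥ σ, every φ ∈ C([-r,0],ℝⁿ) with ‖φ‖ < ρ, and every non-continuable solution x of ẋ(t) = L x_t + N(t)x_t + h(t, x_t) with x_{t₀} = φ, the solution x is defined on all of [t₀-r, ∞) and satisfies sup_{θ∈[-r,0]} |x(t+θ)| ≤ M e^{-β(t-t₀)} ‖φ‖ for all t ≥ t₀. -/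

import Mathlib

open MeasureTheory

/-- `X` is the principal fundamental matrix solution of `ẋ(t) = L x_t`:
`X = O` on `[-r,0)`, `X` continuous on `[0,∞)`, `X(0) = I`, and for every `ξ` and
`t ≥ 0`, `X(t)ξ = ξ + L(θ ↦ ∫_0^{max(t+θ,0)} X(s)ξ ds)`. -/
def IsPFMS {n : ℕ} (r : ℝ)
    (L : C(Set.Icc (-r) (0:ℝ), Fin n → ℝ) →L[ℝ] (Fin n → ℝ))
    (X : ℝ → ((Fin n → ℝ) →L[ℝ] (Fin n → ℝ))) : Prop :=
  (∀ t ∈ Set.Ico (-r) (0:ℝ), X t = 0) ∧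
  ContinuousOn X (Set.Ici (0:ℝ)) ∧ X 0 = 1 ∧
  ∀ ξ : Fin n → ℝ, ∀ t, 0 ≤ t → ∃ ψ : C(Set.Icc (-r) (0:ℝ), Fin n → ℝ),
    (∀ θ : Set.Icc (-r) (0:ℝ), ψ θ = ∫ s in (0:ℝ)..(max (t + (θ : ℝ)) 0), X s ξ) ∧
    X t ξ = ξ + L ψ

/-- `x` is a solution of the RFDE `ẋ(t) = F(t, x_t)` on `[t₀ - r, b)` (`b ∈ (t₀, ∞]`)
with initial history `x_{t₀} = φ` and history segments staying in `U₀`: `x` is continuous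
on `[t₀ - r, b)` and, for `t₀ ≤ t < b`, the history segment `χ = x_t` lies in `U₀` and
`x` is differentiable at `t` (right derivative at `t₀`) with derivative `F(t, x_t)`. -/
def IsSolOn {n : ℕ} (r : ℝ)
    (U₀ : Set C(Set.Icc (-r) (0:ℝ), Fin n → ℝ))
    (F : ℝ × C(Set.Icc (-r) (0:ℝ), Fin n → ℝ) → (Fin n → ℝ))
    (t₀ : ℝ) (b : EReal)
    (φ : C(Set.Icc (-r) (0:ℝ), Fin n → ℝ)) (x : ℝ → Fin n → ℝ) : Prop :=
  (t₀ : EReal) < b ∧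
  (∀ θ : Set.Icc (-r) (0:ℝ), x (t₀ + θ) = φ θ) ∧
  ContinuousOn x {t : ℝ | t₀ - r ≤ t ∧ (t : EReal) < b} ∧
  ∀ t : ℝ, t₀ ≤ t → (t : EReal) < b →
    ∃ χ : C(Set.Icc (-r) (0:ℝ), Fin n → ℝ),
      (∀ θ : Set.Icc (-r) (0:ℝ), χ θ = x (t + θ)) ∧ χ ∈ U₀ ∧
      HasDerivWithinAt x (F (t, χ)) (Set.Ici t₀) t

/-- A solution on `[t₀ - r, b)` is non-continuable if no solution on a strictly larger
interval `[t₀ - r, b')` restricts to it. -/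
def IsNoncontinuableSol {n : ℕ} (r : ℝ)
    (U₀ : Set C(Set.Icc (-r) (0:ℝ), Fin n → ℝ))
    (F : ℝ × C(Set.Icc (-r) (0:ℝ), Fin n → ℝ) → (Fin n → ℝ))
    (t₀ : ℝ) (b : EReal)
    (φ : C(Set.Icc (-r) (0:ℝ), Fin n → ℝ)) (x : ℝ → Fin n → ℝ) : Prop :=
  IsSolOn r U₀ F t₀ b φ x ∧
  ∀ (b' : EReal) (x' : ℝ → Fin n → ℝ), b < b' → IsSolOn r U₀ F t₀ b' φ x' →
    ¬ ∀ t : ℝ, t₀ - r ≤ t → (t : EReal) < b → x' t = x t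


section Auxiliary

open Set Filter Topology

variable {E : Type*} [NormedAddCommGroup E] {r : ℝ}

/-- The history segment `θ ↦ x (t + θ)` of a continuous function on the line. -/
def histSegment (r : ℝ) (x : C(ℝ, E)) (t : ℝ) : C(Icc (-r) (0 : ℝ), E) :=
  ⟨fun θ => x (t + θ), by fun_prop⟩

@[simp]
lemma histSegment_apply (x : C(ℝ, E)) (t : ℝ) (θ : Icc (-r) (0 : ℝ)) :
    histSegment r x t θ = x (t + θ) := rfl

lemma continuous_histSegment_uncurry :
    Continuous fun p : C(ℝ, E) × ℝ => histSegment r p.1 p.2 := by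
  refine ContinuousMap.continuous_of_continuous_uncurry _ ?_
  change Continuous fun q : (C(ℝ, E) × ℝ) × Icc (-r) (0 : ℝ) => q.1.1 (q.1.2 + q.2)
  fun_prop

lemma continuous_histSegment (x : C(ℝ, E)) : Continuous (histSegment r x) :=
  continuous_histSegment_uncurry.comp (Continuous.prodMk_right x)

lemma norm_histSegment_le {x : C(ℝ, E)} {t m : ℝ} (hm : 0 ≤ m)
    (h : ∀ s ∈ Icc (t - r) t, ‖x s‖ ≤ m) : ‖histSegment r x t‖ ≤ m :=
  (ContinuousMap.norm_le _ hm).2 fun θ =>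
    h _ ⟨by linarith [θ.2.1], by linarith [θ.2.2]⟩

lemma histSegment_congr {x y : C(ℝ, E)} {t : ℝ} (h : ∀ s ∈ Icc (t - r) t, x s = y s) :
    histSegment r x t = histSegment r y t :=
  ContinuousMap.ext fun θ => h _ ⟨by linarith [θ.2.1], by linarith [θ.2.2]⟩

lemma isCompact_setOf_lipschitz_eq_zero [ProperSpace E] (b K : ℝ) :
    IsCompact {v : C(ℝ, E) | (∀ t ≤ b, v t = 0) ∧ ∀ s t, ‖v s - v t‖ ≤ K * |s - t|} := by
  apply ArzelaAscoli.isCompact_of_equicontinuous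
  · have himage : ContinuousMap.toFun ''
        {v : C(ℝ, E) | (∀ t ≤ b, v t = 0) ∧ ∀ s t, ‖v s - v t‖ ≤ K * |s - t|} =
        {v : ℝ → E | (∀ t ≤ b, v t = 0) ∧ ∀ s t, ‖v s - v t‖ ≤ K * |s - t|} := by
      ext v
      constructor
      · rintro ⟨w, hw, rfl⟩
        exact hw
      · intro hv
        have hlip : LipschitzWith (Real.toNNReal K) v := LipschitzWith.of_dist_le_mul fun s t => by
          rw [dist_eq_norm, Real.dist_eq]
          exact (hv.2 s t).trans (by gcongr; exact Real.le_coe_toNNReal K)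
        exact ⟨⟨v, hlip.continuous⟩, hv, rfl⟩
    rw [himage]
    refine IsCompact.of_isClosed_subset
      (isCompact_univ_pi fun t : ℝ => isCompact_closedBall (0 : E) (K * |t - b|)) ?_ ?_
    · simp only [Set.ofPred_and, Set.ofPred_forall]
      refine IsClosed.inter ?_ ?_
      · exact isClosed_iInter fun t => isClosed_iInter fun _ =>
          isClosed_eq (continuous_apply t) continuous_const
      · exact isClosed_iInter fun s => isClosed_iInter fun t =>
          isClosed_le ((continuous_apply s).sub (continuous_apply t)).norm continuous_const
    · intro v hv t _
      have := hv.2 t b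
      rw [hv.1 b le_rfl, sub_zero] at this
      simpa using this
  · refine (LipschitzWith.uniformEquicontinuous _ (Real.toNNReal K) fun v => ?_).equicontinuous
    refine LipschitzWith.of_dist_le_mul fun s t => ?_
    rw [dist_eq_norm, Real.dist_eq]
    exact (v.2.2 s t).trans (by gcongr; exact Real.le_coe_toNNReal K)

variable [NormedSpace ℝ E]

/-- Gronwall inequality for delay differential inequalities. -/
lemma norm_le_of_delay_deriv_bound {u u' : ℝ → E} {a T c Λ : ℝ} (hr : 0 ≤ r)
    (hc : 0 ≤ c) (hΛ : 0 < Λ) (hu : ContinuousOn u (Icc a T))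
    (hu' : ∀ t ∈ Ico a T, HasDerivWithinAt u (u' t) (Ici t) t)
    (hhist : ∀ s ∈ Icc (a - r) a, ‖u s‖ ≤ c)
    (hbound : ∀ t ∈ Ico a T, ∀ m, (∀ s ∈ Icc (t - r) t, ‖u s‖ ≤ m) → ‖u' t‖ ≤ Λ * m) :
    ∀ t ∈ Icc a T, ‖u t‖ ≤ 2 * c * Real.exp (2 * Λ * (t - a)) := by
  intro t₁ ht₁
  have hcont : ContinuousOn (fun t => Real.exp (-(2 * Λ * (t - a))) * ‖u t‖) (Icc a T) :=
    ContinuousOn.mul (by fun_prop) hu.norm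
  obtain ⟨p, hp, hmax⟩ := isCompact_Icc.exists_isMaxOn ⟨t₁, ht₁⟩ hcont
  set S := Real.exp (-(2 * Λ * (p - a))) * ‖u p‖ with hS
  have key : ∀ t ∈ Icc a T, ‖u t‖ ≤ S * Real.exp (2 * Λ * (t - a)) := by
    intro t ht
    have h1 : Real.exp (-(2 * Λ * (t - a))) * ‖u t‖ ≤ S := hmax ht
    calc ‖u t‖ = (Real.exp (-(2 * Λ * (t - a))) * ‖u t‖) * Real.exp (2 * Λ * (t - a)) := by
          rw [mul_right_comm, ← Real.exp_add]; simp
      _ ≤ _ := by gcongr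
  set K := max c S with hK
  have hK0 : 0 ≤ K := hc.trans (le_max_left _ _)
  have hder : ∀ t ∈ Ico a T, ‖u' t‖ ≤ K * Λ * Real.exp (2 * Λ * (t - a)) := by
    intro t ht
    have := hbound t ht (K * Real.exp (2 * Λ * (t - a))) ?_
    · linarith
    intro s hs
    rcases le_total s a with hsa | hsa
    · have h1 : (1 : ℝ) ≤ Real.exp (2 * Λ * (t - a)) :=
        Real.one_le_exp (mul_nonneg (by linarith) (by linarith [ht.1]))
      calc ‖u s‖ ≤ c := hhist s ⟨by linarith [hs.1, ht.1], hsa⟩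
        _ ≤ K := le_max_left _ _
        _ ≤ _ := le_mul_of_one_le_right hK0 h1
    · calc ‖u s‖ ≤ S * Real.exp (2 * Λ * (s - a)) := key s ⟨hsa, by linarith [hs.2, ht.2]⟩
        _ ≤ K * Real.exp (2 * Λ * (t - a)) := by
          gcongr
          · exact le_max_right _ _
          · exact hs.2
  have hB : ∀ t, HasDerivAt (fun t => c + K / 2 * Real.exp (2 * Λ * (t - a)))
      (K * Λ * Real.exp (2 * Λ * (t - a))) t := by
    intro t
    have h1 : HasDerivAt (fun t => 2 * Λ * (t - a)) (2 * Λ * 1) t :=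
      ((hasDerivAt_id t).sub_const a).const_mul _
    exact ((h1.exp.const_mul (K / 2)).const_add c).congr_deriv (by ring)
  have hp' := image_norm_le_of_norm_deriv_right_le_deriv_boundary hu hu'
    (B := fun t => c + K / 2 * Real.exp (2 * Λ * (t - a)))
    (by
      have := hhist a ⟨by linarith, le_rfl⟩
      have h2 : 0 ≤ K / 2 * Real.exp (2 * Λ * (a - a)) := by positivity
      linarith) hB hder hp
  have hSle : S ≤ c + K / 2 := by
    have h1 : (Real.exp (-(2 * Λ * (p - a)))) ≤ 1 :=
      Real.exp_le_one_iff.2 (by nlinarith [hp.1])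
    calc S ≤ Real.exp (-(2 * Λ * (p - a))) * (c + K / 2 * Real.exp (2 * Λ * (p - a))) := by
          rw [hS]; gcongr
      _ = Real.exp (-(2 * Λ * (p - a))) * c +
          K / 2 * (Real.exp (-(2 * Λ * (p - a)) + 2 * Λ * (p - a))) := by
          rw [Real.exp_add]; ring
      _ ≤ 1 * c + K / 2 * 1 := by
          gcongr
          simp
      _ = _ := by ring
  have hS2 : S ≤ 2 * c := by
    rcases max_choice c S with h | h <;> rw [← hK] at h <;> linarith
  exact (key t₁ ht₁).trans (by gcongr)

section VariationOfConstants

/-- Cutting an operator-valued function off to the positive half-line turns integrals over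
`[p, q]` with `p ≤ 0` into integrals over `[0, max q 0]`. -/
lemma intervalIntegral_indicator_Ioi {f : ℝ → E} (hf : Continuous f) {p q : ℝ}
    (hp : p ≤ 0) :
    ∫ u in p..q, (Ioi (0 : ℝ)).indicator f u = ∫ u in (0 : ℝ)..max q 0, f u := by
  have hneg : ∀ q ≤ 0, ∫ u in p..q, (Ioi (0 : ℝ)).indicator f u = 0 := by
    intro q hq
    rw [intervalIntegral.integral_congr_ae (g := fun _ => 0)]
    · simp
    · refine ae_of_all _ fun u hu => indicator_of_notMem ?_ _
      simp only [mem_Ioi, not_lt]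
      exact hu.2.trans (max_le hp hq)
  rcases le_total q 0 with hq | hq
  · rw [hneg q hq, max_eq_right hq, intervalIntegral.integral_same]
  · have hintegral : ∀ c d : ℝ, IntervalIntegrable ((Ioi (0 : ℝ)).indicator f) volume c d :=
      fun c d => by
        have := hf.intervalIntegrable (μ := volume) c d
        exact ⟨this.1.indicator measurableSet_Ioi, this.2.indicator measurableSet_Ioi⟩
    rw [← intervalIntegral.integral_add_adjacent_intervals (hintegral p 0) (hintegral 0 q),
      hneg 0 le_rfl, zero_add, max_eq_left hq]
    refine intervalIntegral.integral_congr_ae (ae_of_all _ fun u hu => indicator_of_mem ?_ _)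
    rw [uIoc_of_le hq] at hu
    exact hu.1

/-- The convolution `∫ s in a..t, X (t - s) (g s)`, extended by zero to the left of `a`. -/
noncomputable def causalConvolution {X : ℝ → E →L[ℝ] E} (hX : Continuous X) (g : C(ℝ, E)) (a : ℝ) :
    C(ℝ, E) where
  toFun t := ∫ s in a..max t a, X (t - s) (g s)
  continuous_toFun := by
    refine intervalIntegral.continuous_parametric_intervalIntegral_of_continuous ?_ (by fun_prop)
    change Continuous fun p : ℝ × ℝ => X (p.1 - p.2) (g p.2)
    fun_prop

lemma causalConvolution_apply {X : ℝ → E →L[ℝ] E} (hX : Continuous X) (g : C(ℝ, E)) (a t : ℝ) :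
    causalConvolution hX g a t = ∫ s in a..max t a, X (t - s) (g s) := rfl

lemma causalConvolution_of_le {X : ℝ → E →L[ℝ] E} (hX : Continuous X) (g : C(ℝ, E)) {a t : ℝ}
    (h : t ≤ a) : causalConvolution hX g a t = 0 := by
  rw [causalConvolution_apply, max_eq_right h, intervalIntegral.integral_same]

lemma causalConvolution_eq_indicator {X : ℝ → E →L[ℝ] E} (hX : Continuous X) (g : C(ℝ, E))
    {a d τ : ℝ} (haτ : a ≤ τ) (hτd : τ ≤ d) :
    causalConvolution hX g a τ =
      ∫ s in a..d, (Ioi (0 : ℝ)).indicator (fun u => X u (g s)) (τ - s) := by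
  have hcongr₁ : EqOn (fun s => X (τ - s) (g s))
      (fun s => (Ioi (0 : ℝ)).indicator (fun u => X u (g s)) (τ - s)) (Ioo a τ) := fun s hs => by
    simp [hs.2]
  have hcongr₂ : EqOn (fun _ => (0 : E))
      (fun s => (Ioi (0 : ℝ)).indicator (fun u => X u (g s)) (τ - s)) (Ioc τ d) := fun s hs => by
    simp [hs.1.le]
  have hcont : Continuous fun s => X (τ - s) (g s) := by fun_prop
  have hi₁ : IntervalIntegrable
      (fun s => (Ioi (0 : ℝ)).indicator (fun u => X u (g s)) (τ - s)) volume a τ := by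
    rw [intervalIntegrable_iff_integrableOn_Ioo_of_le haτ]
    refine IntegrableOn.congr_fun ?_ hcongr₁ measurableSet_Ioo
    rw [← intervalIntegrable_iff_integrableOn_Ioo_of_le haτ]
    exact hcont.intervalIntegrable _ _
  have hi₂ : IntervalIntegrable
      (fun s => (Ioi (0 : ℝ)).indicator (fun u => X u (g s)) (τ - s)) volume τ d := by
    rw [intervalIntegrable_iff_integrableOn_Ioc_of_le hτd]
    exact IntegrableOn.congr_fun integrableOn_zero hcongr₂ measurableSet_Ioc
  rw [← intervalIntegral.integral_add_adjacent_intervals hi₁ hi₂, causalConvolution_apply,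
    max_eq_left haτ]
  have h₂ : ∫ s in τ..d, (Ioi (0 : ℝ)).indicator (fun u => X u (g s)) (τ - s) = 0 := by
    rw [intervalIntegral.integral_of_le hτd, ← setIntegral_congr_fun measurableSet_Ioc hcongr₂]
    simp
  rw [h₂, add_zero, intervalIntegral.integral_of_le haτ, intervalIntegral.integral_of_le haτ,
    integral_Ioc_eq_integral_Ioo, integral_Ioc_eq_integral_Ioo,
    setIntegral_congr_fun measurableSet_Ioo hcongr₁]

/-- Fubini for the causal convolution. -/
lemma integral_causalConvolution {X : ℝ → E →L[ℝ] E} (hX : Continuous X) (g : C(ℝ, E))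
    {a c d : ℝ} (hcd : c ≤ d) (had : a ≤ d) :
    ∫ τ in a..max c a, causalConvolution hX g a τ =
      ∫ s in a..d, ∫ u in (0 : ℝ)..max (c - s) 0, X u (g s) := by
  have h₁ : ∫ τ in a..max c a, causalConvolution hX g a τ = ∫ τ in a..max c a, ∫ s in a..d,
      (Ioi (0 : ℝ)).indicator (fun u => X u (g s)) (τ - s) := by
    refine intervalIntegral.integral_congr fun τ hτ => ?_
    rw [uIcc_of_le (le_max_right _ _)] at hτ
    exact causalConvolution_eq_indicator hX g hτ.1 (hτ.2.trans (max_le hcd had))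
  rw [h₁, intervalIntegral_intervalIntegral_swap]
  · refine intervalIntegral.integral_congr fun s hs => ?_
    rw [uIcc_of_le had] at hs
    have hXs : Continuous fun u => X u (g s) := by fun_prop
    rw [intervalIntegral.integral_comp_sub_right
        (fun v => (Ioi (0 : ℝ)).indicator (fun u => X u (g s)) v) s,
      intervalIntegral_indicator_Ioi hXs (by linarith [hs.1])]
    congr 1
    rcases le_total c a with h | h
    · rw [max_eq_right h, max_eq_right (by linarith [hs.1]), max_eq_right (by linarith [hs.1])]
    · rw [max_eq_left h]
  · have hcont : Continuous fun p : ℝ × ℝ => X (p.1 - p.2) (g p.2) := by fun_prop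
    have hms : MeasurableSet {p : ℝ × ℝ | 0 < p.1 - p.2} :=
      (isOpen_lt continuous_const (by fun_prop)).measurableSet
    have heq : Function.uncurry (fun τ s : ℝ =>
        (Ioi (0 : ℝ)).indicator (fun u => X u (g s)) (τ - s)) =
        {p : ℝ × ℝ | 0 < p.1 - p.2}.indicator (fun p : ℝ × ℝ => X (p.1 - p.2) (g p.2)) := by
      ext p
      simp [Function.uncurry, indicator]
    rw [heq]
    refine IntegrableOn.indicator ?_ hms
    exact ((hcont.continuousOn.integrableOn_compact
      (isCompact_uIcc.prod isCompact_uIcc)).mono_set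
      (prod_mono uIoc_subset_uIcc uIoc_subset_uIcc))

lemma norm_causalConvolution_le {X : ℝ → E →L[ℝ] E} (hX : Continuous X) {g : C(ℝ, E)}
    {M₀ α β B a t : ℝ} (hM₀ : 0 ≤ M₀) (hB : 0 ≤ B) (hβ : β < α)
    (hdecay : ∀ t, 0 ≤ t → ‖X t‖ ≤ M₀ * Real.exp (-α * t)) (hat : a ≤ t)
    (hg : ∀ s ∈ Icc a t, ‖g s‖ ≤ B * Real.exp (-β * (s - a))) :
    ‖causalConvolution hX g a t‖ ≤ M₀ * B / (α - β) * Real.exp (-β * (t - a)) := by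
  have hαβ : 0 < α - β := sub_pos.2 hβ
  rw [causalConvolution_apply, max_eq_left hat]
  set G : ℝ → ℝ := fun s => Real.exp (-α * (t - s) + -β * (s - a)) with hG
  have hGcont : Continuous fun s => M₀ * B * G s := by fun_prop
  have hbound : ‖∫ s in a..t, X (t - s) (g s)‖ ≤ ∫ s in a..t, M₀ * B * G s := by
    refine intervalIntegral.norm_integral_le_of_norm_le hat (ae_of_all _ fun s hs => ?_)
      (hGcont.intervalIntegrable _ _)
    calc ‖X (t - s) (g s)‖ ≤ ‖X (t - s)‖ * ‖g s‖ := (X (t - s)).le_opNorm _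
      _ ≤ (M₀ * Real.exp (-α * (t - s))) * (B * Real.exp (-β * (s - a))) := by
        gcongr
        · exact hdecay _ (by linarith [hs.2])
        · exact hg s ⟨hs.1.le, hs.2⟩
      _ = M₀ * B * G s := by simp only [hG, Real.exp_add]; ring
  have hder : ∀ s ∈ uIcc a t, HasDerivAt (fun s => M₀ * B / (α - β) * G s) (M₀ * B * G s) s := by
    intro s _
    have h1 : HasDerivAt (fun s => -α * (t - s) + -β * (s - a)) (-α * (-1) + -β * 1) s :=
      (((hasDerivAt_id s).const_sub t).const_mul _).add
        (((hasDerivAt_id s).sub_const a).const_mul _)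
    refine (h1.exp.const_mul (M₀ * B / (α - β))).congr_deriv ?_
    simp only [hG]
    field_simp
    ring
  rw [intervalIntegral.integral_eq_sub_of_hasDerivAt hder (hGcont.intervalIntegrable _ _)]
    at hbound
  refine hbound.trans ?_
  have h1 : G t = Real.exp (-β * (t - a)) := by simp [hG]
  have h2 : 0 ≤ M₀ * B / (α - β) * G a := by positivity
  rw [h1]
  linarith

variable [CompleteSpace E]

/-- The convolution with a resolvent of `L` solves the inhomogeneous equation with zero
initial history. -/
lemma causalConvolution_eq_integral {L : C(Icc (-r) (0 : ℝ), E) →L[ℝ] E}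
    {X : ℝ → E →L[ℝ] E} (hX : Continuous X)
    (hres : ∀ ξ : E, ∀ t, 0 ≤ t → ∃ ψ : C(Icc (-r) (0 : ℝ), E),
      (∀ θ : Icc (-r) (0 : ℝ), ψ θ = ∫ s in (0 : ℝ)..(max (t + (θ : ℝ)) 0), X s ξ) ∧
      X t ξ = ξ + L ψ)
    (g : C(ℝ, E)) {a t : ℝ} (hat : a ≤ t) :
    causalConvolution hX g a t =
      ∫ s in a..t, (L (histSegment r (causalConvolution hX g a) s) + g s) := by
  set w := causalConvolution hX g a with hw
  have hprim : Continuous fun u : ℝ => ∫ v in (0 : ℝ)..max u 0, X v :=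
    (intervalIntegral.continuous_primitive (fun _ _ => hX.intervalIntegrable _ _) 0).comp
      (by fun_prop)
  let Ψ : C(ℝ, C(Icc (-r) (0 : ℝ), E)) := ContinuousMap.curry
    ⟨fun p : ℝ × Icc (-r) (0 : ℝ) => (∫ v in (0 : ℝ)..max (t + p.2 - p.1) 0, X v) (g p.1),
      (hprim.comp (g := fun u : ℝ => ∫ v in (0 : ℝ)..max u 0, X v)
        (f := fun p : ℝ × Icc (-r) (0 : ℝ) => t + p.2 - p.1) (by fun_prop)).clm_apply
        (by fun_prop)⟩
  have hΨ : ∀ s θ, Ψ s θ = ∫ v in (0 : ℝ)..max (t + (θ : ℝ) - s) 0, X v (g s) := fun s θ =>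
    ContinuousLinearMap.intervalIntegral_apply (hX.intervalIntegrable _ _) _
  have hstep : ∀ s ∈ Icc a t, X (t - s) (g s) = g s + L (Ψ s) := by
    intro s hs
    obtain ⟨ψ, hψ, hXψ⟩ := hres (g s) (t - s) (by linarith [hs.2])
    rw [hXψ]
    congr 2
    ext1 θ
    rw [hψ, hΨ]
    congr 2
    ring
  have hH : Continuous (histSegment r w) := continuous_histSegment w
  have hswap : ∫ s in a..t, Ψ s = ∫ s in a..t, histSegment r w s := by
    ext1 θ
    have hev : ∀ f : ℝ → C(Icc (-r) (0 : ℝ), E), Continuous f →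
        (∫ s in a..t, f s) θ = ∫ s in a..t, f s θ := fun f hf =>
      ((ContinuousMap.evalCLM ℝ θ).intervalIntegral_comp_comm (hf.intervalIntegrable a t)).symm
    rw [hev _ Ψ.continuous, hev _ hH]
    simp only [hΨ, histSegment_apply]
    rw [← integral_causalConvolution hX g (by linarith [θ.2.2]) hat,
      intervalIntegral.integral_comp_add_right (fun s => w s) (θ : ℝ), ← hw]
    have hzero : ∀ p q : ℝ, p ≤ a → q ≤ a → ∫ s in p..q, w s = 0 := by
      intro p q hp hq
      rw [intervalIntegral.integral_congr (g := fun _ => 0)]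
      · simp
      · intro s hs
        exact causalConvolution_of_le hX g (hs.2.trans (max_le hp hq))
    have hi : ∀ p q : ℝ, IntervalIntegrable w volume p q :=
      fun p q => w.continuous.intervalIntegrable p q
    have hθ : a + (θ : ℝ) ≤ a := by linarith [θ.2.2]
    rw [← intervalIntegral.integral_add_adjacent_intervals (hi (a + θ) a) (hi a (t + θ)),
      hzero _ _ hθ le_rfl, zero_add]
    rcases le_total (t + (θ : ℝ)) a with h | h
    · rw [max_eq_right h, intervalIntegral.integral_same, hzero _ _ le_rfl h]
    · rw [max_eq_left h]
  have hLH : Continuous fun s => L (histSegment r w s) := by fun_prop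
  have hLΨ : Continuous fun s => L (Ψ s) := by fun_prop
  rw [intervalIntegral.integral_add (hLH.intervalIntegrable _ _)
      (g.continuous.intervalIntegrable _ _),
    L.intervalIntegral_comp_comm (hH.intervalIntegrable _ _), ← hswap,
    ← L.intervalIntegral_comp_comm (Ψ.continuous.intervalIntegrable _ _), hw,
    causalConvolution_apply, max_eq_left hat, add_comm,
    ← intervalIntegral.integral_add (g.continuous.intervalIntegrable _ _)
      (hLΨ.intervalIntegrable _ _)]
  refine intervalIntegral.integral_congr fun s hs => ?_
  rw [uIcc_of_le hat] at hs
  exact hstep s hs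

/-- Variation of constants formula for zero initial history. -/
lemma eq_causalConvolution {L : C(Icc (-r) (0 : ℝ), E) →L[ℝ] E} (hr : 0 ≤ r)
    {X : ℝ → E →L[ℝ] E} (hX : Continuous X)
    (hres : ∀ ξ : E, ∀ t, 0 ≤ t → ∃ ψ : C(Icc (-r) (0 : ℝ), E),
      (∀ θ : Icc (-r) (0 : ℝ), ψ θ = ∫ s in (0 : ℝ)..(max (t + (θ : ℝ)) 0), X s ξ) ∧
      X t ξ = ξ + L ψ)
    (g y : C(ℝ, E)) {a T : ℝ} (hy₀ : ∀ t ≤ a, y t = 0)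
    (hy : ∀ t ∈ Ico a T, HasDerivWithinAt y (L (histSegment r y t) + g t) (Ici t) t) :
    ∀ t ∈ Icc a T, y t = causalConvolution hX g a t := by
  set w := causalConvolution hX g a with hw
  have hw' : ∀ t ∈ Ico a T, HasDerivWithinAt w (L (histSegment r w t) + g t) (Ici t) t := by
    intro t ht
    have hc : Continuous fun s => L (histSegment r w s) + g s :=
      (L.continuous.comp (continuous_histSegment w)).add g.continuous
    have hd := (hc.integral_hasStrictDerivAt a t).hasDerivAt.hasDerivWithinAt (s := Ici t)
    refine hd.congr (fun s hs => ?_) ?_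
    · exact causalConvolution_eq_integral hX hres g (ht.1.trans hs)
    · exact causalConvolution_eq_integral hX hres g ht.1
  intro t ht
  have hd := norm_le_of_delay_deriv_bound (u := fun t => (y - w) t)
    (u' := fun t => L (histSegment r (y - w) t)) (c := 0) (Λ := ‖L‖ + 1) hr le_rfl
    (by positivity) (y - w).continuous.continuousOn (T := T) (a := a)
    (fun t ht => by
      have := (hy t ht).sub (hw' t ht)
      refine this.congr_deriv ?_
      have : histSegment r (y - w) t = histSegment r y t - histSegment r w t := rfl
      rw [this, map_sub]
      abel)
    (fun s hs => by simp [hy₀ s hs.2, hw, causalConvolution_of_le hX g hs.2])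
    (fun t ht m hm => by
      have hm0 : 0 ≤ m := (norm_nonneg _).trans (hm t ⟨by linarith, le_rfl⟩)
      calc ‖L (histSegment r (y - w) t)‖ ≤ ‖L‖ * ‖histSegment r (y - w) t‖ := L.le_opNorm _
        _ ≤ (‖L‖ + 1) * m := by
          gcongr
          · linarith
          · exact norm_histSegment_le hm0 hm) t ht
  have : ‖y t - w t‖ ≤ 0 := by simpa using hd
  exact sub_eq_zero.1 (norm_le_zero_iff.1 this)

lemma exists_smooth_cutoff (hr : 0 < r) : ∃ χ χ' : C(ℝ, ℝ), ∃ κ : ℝ, 0 ≤ κ ∧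
    (∀ t, HasDerivAt χ (χ' t) t) ∧ (∀ t, χ t ∈ Icc (0 : ℝ) 1) ∧ (∀ t ≤ 0, χ t = 0) ∧
    (∀ t, r ≤ t → χ t = 1) ∧ (∀ t ∈ Icc 0 (2 * r), |χ' t| ≤ κ) ∧ ∀ t, 2 * r ≤ t → χ' t = 0 := by
  have hs : ContDiff ℝ 1 fun t : ℝ => Real.smoothTransition (t / r) :=
    (Real.smoothTransition.contDiff (n := 1)).comp (by fun_prop)
  have hone : ∀ t, r ≤ t → Real.smoothTransition (t / r) = 1 := fun t ht =>
    Real.smoothTransition.one_of_one_le ((one_le_div hr).2 ht)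
  have hcd : Continuous (deriv fun t : ℝ => Real.smoothTransition (t / r)) :=
    hs.continuous_deriv le_rfl
  obtain ⟨κ, hκ⟩ := (isCompact_Icc (a := (0 : ℝ)) (b := 2 * r)).exists_bound_of_continuousOn
    hcd.continuousOn
  refine ⟨⟨_, hs.continuous⟩, ⟨_, hcd⟩, κ, (norm_nonneg _).trans (hκ 0 ⟨le_rfl, by linarith⟩),
    fun t => (hs.differentiable one_ne_zero t).hasDerivAt,
    fun t => ⟨Real.smoothTransition.nonneg _, Real.smoothTransition.le_one _⟩,
    fun t ht => Real.smoothTransition.zero_of_nonpos (div_nonpos_of_nonpos_of_nonneg ht hr.le),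
    hone, hκ, fun t ht => ?_⟩
  have : (fun t : ℝ => Real.smoothTransition (t / r)) =ᶠ[𝓝 t] fun _ => 1 := by
    filter_upwards [Ioi_mem_nhds (show r < t by linarith)] with s hs
    exact hone s (le_of_lt hs)
  change deriv (fun t : ℝ => Real.smoothTransition (t / r)) t = 0
  rw [this.deriv_eq, deriv_const]

/-- Exponential decay persists under small perturbations, with a bound in terms of the size of
the solution on an initial interval. -/
lemma exists_decay_of_small_perturbation {L : C(Icc (-r) (0 : ℝ), E) →L[ℝ] E} (hr : 0 < r)
    {X : ℝ → E →L[ℝ] E} (hX : Continuous X)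
    (hres : ∀ ξ : E, ∀ t, 0 ≤ t → ∃ ψ : C(Icc (-r) (0 : ℝ), E),
      (∀ θ : Icc (-r) (0 : ℝ), ψ θ = ∫ s in (0 : ℝ)..(max (t + (θ : ℝ)) 0), X s ξ) ∧
      X t ξ = ξ + L ψ)
    {M₀ α : ℝ} (hM₀ : 1 ≤ M₀) (hα : 0 < α)
    (hdecay : ∀ t, 0 ≤ t → ‖X t‖ ≤ M₀ * Real.exp (-α * t)) :
    ∃ ε > 0, ∃ C ≥ 0, ∀ (x q : C(ℝ, E)) (a T D : ℝ), 0 ≤ D →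
      (∀ t ∈ Ico a T, HasDerivWithinAt x (L (histSegment r x t) + q t) (Ici t) t) →
      (∀ t ∈ Icc a T, ‖q t‖ ≤ ε * ‖histSegment r x t‖) →
      (∀ t ∈ Icc (a - r) (a + 2 * r), t ≤ T → ‖x t‖ ≤ D) →
      ∀ t ∈ Icc (a + r) T, ‖x t‖ ≤ C * D * Real.exp (-(α / 2) * (t - a)) := by
  obtain ⟨χ, χ', κ, hκ, hχ, hχ01, hχ0, hχ1, hχ'κ, hχ'0⟩ := exists_smooth_cutoff hr
  set β := α / 2 with hβ
  have hβ0 : 0 < β := by positivity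
  set ε := α / (8 * M₀ * Real.exp (β * r)) with hε
  have hε0 : 0 < ε := by positivity
  set A := κ + (‖L‖ + ε) + ‖L‖ with hA
  have hA0 : 0 ≤ A := by positivity
  refine ⟨ε, hε0, 4 * M₀ * (A * Real.exp (β * (2 * r))) / α, by positivity, ?_⟩
  intro x q a T D hD hx hq hxD t₁ ht₁
  have haT : a ≤ T := by linarith [ht₁.1, ht₁.2]
  let y : C(ℝ, E) := ⟨fun t => χ (t - a) • x t, by fun_prop⟩
  have hy_apply : ∀ t, y t = χ (t - a) • x t := fun t => rfl
  have hyx : ∀ t, ‖y t‖ ≤ ‖x t‖ := fun t => by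
    rw [hy_apply, norm_smul, Real.norm_of_nonneg (hχ01 _).1]
    exact mul_le_of_le_one_left (norm_nonneg _) (hχ01 _).2
  have hy_eq : ∀ t, a + r ≤ t → y t = x t := fun t ht => by
    rw [hy_apply, hχ1 _ (by linarith), one_smul]
  let g : C(ℝ, E) := ⟨fun t => χ' (t - a) • x t + χ (t - a) • (L (histSegment r x t) + q t) -
    L (histSegment r y t), by
      have h1 := continuous_histSegment (r := r) x
      have h2 := continuous_histSegment (r := r) y
      fun_prop⟩
  have hg_apply : ∀ t, g t = χ' (t - a) • x t + χ (t - a) • (L (histSegment r x t) + q t) -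
    L (histSegment r y t) := fun t => rfl
  have hy : ∀ t ∈ Ico a T, HasDerivWithinAt y (L (histSegment r y t) + g t) (Ici t) t := by
    intro t ht
    have h1 : HasDerivAt (fun s => χ (s - a)) (χ' (t - a)) t := by
      simpa using (hχ (t - a)).comp_sub_const t a
    refine (h1.hasDerivWithinAt.smul (hx t ht)).congr_deriv ?_
    rw [hg_apply]
    abel
  have hrep := eq_causalConvolution hr.le hX hres g y
    (fun t ht => by rw [hy_apply, hχ0 _ (by linarith), zero_smul]) hy
  have hcont : ContinuousOn (fun t => Real.exp (β * (t - a)) * ‖y t‖) (Icc a T) := by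
    fun_prop
  obtain ⟨p, hp, hmax⟩ := isCompact_Icc.exists_isMaxOn ⟨a, le_rfl, haT⟩ hcont
  set S := Real.exp (β * (p - a)) * ‖y p‖ with hS
  have hS0 : 0 ≤ S := by positivity
  have key : ∀ t ∈ Icc a T, ‖y t‖ ≤ S * Real.exp (-β * (t - a)) := by
    intro t ht
    have h1 : Real.exp (β * (t - a)) * ‖y t‖ ≤ S := hmax ht
    calc ‖y t‖ = (Real.exp (β * (t - a)) * ‖y t‖) * Real.exp (-β * (t - a)) := by
          rw [mul_right_comm, ← Real.exp_add]; simp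
      _ ≤ _ := by gcongr
  set B := A * D * Real.exp (β * (2 * r)) + ε * S * Real.exp (β * r) with hB
  have hg : ∀ s ∈ Icc a T, ‖g s‖ ≤ B * Real.exp (-β * (s - a)) := by
    intro s hs
    rcases le_total s (a + 2 * r) with hs2 | hs2
    · have hxs : ∀ u ∈ Icc (s - r) s, ‖x u‖ ≤ D := fun u hu =>
        hxD u ⟨by linarith [hs.1, hu.1], by linarith [hu.2]⟩ (hu.2.trans hs.2)
      have hHx : ‖histSegment r x s‖ ≤ D := norm_histSegment_le hD hxs
      have hHy : ‖histSegment r y s‖ ≤ D :=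
        norm_histSegment_le hD fun u hu => (hyx u).trans (hxs u hu)
      have h1 : ‖χ' (s - a) • x s‖ ≤ κ * D := by
        rw [norm_smul]
        gcongr
        · exact hχ'κ _ ⟨by linarith [hs.1], by linarith⟩
        · exact hxs s ⟨by linarith, le_rfl⟩
      have h2 : ‖χ (s - a) • (L (histSegment r x s) + q s)‖ ≤ (‖L‖ + ε) * D := by
        rw [norm_smul, Real.norm_of_nonneg (hχ01 _).1]
        refine (mul_le_of_le_one_left (norm_nonneg _) (hχ01 _).2).trans ?_
        calc ‖L (histSegment r x s) + q s‖ ≤ ‖L (histSegment r x s)‖ + ‖q s‖ := norm_add_le _ _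
          _ ≤ ‖L‖ * D + ε * D := by
            gcongr
            · exact (L.le_opNorm _).trans (by gcongr)
            · exact (hq s hs).trans (by gcongr)
          _ = _ := by ring
      have h3 : ‖L (histSegment r y s)‖ ≤ ‖L‖ * D := (L.le_opNorm _).trans (by gcongr)
      have h4 : ‖g s‖ ≤ A * D := by
        rw [hg_apply]
        refine (norm_sub_le _ _).trans ?_
        have := norm_add_le (χ' (s - a) • x s) (χ (s - a) • (L (histSegment r x s) + q s))
        rw [hA]
        linarith
      have h5 : (1 : ℝ) ≤ Real.exp (β * (2 * r)) * Real.exp (-β * (s - a)) := by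
        rw [← Real.exp_add]
        exact Real.one_le_exp (by nlinarith)
      calc ‖g s‖ ≤ A * D * 1 := by simpa using h4
        _ ≤ A * D * (Real.exp (β * (2 * r)) * Real.exp (-β * (s - a))) := by gcongr
        _ ≤ A * D * (Real.exp (β * (2 * r)) * Real.exp (-β * (s - a))) +
            ε * S * Real.exp (β * r) * Real.exp (-β * (s - a)) :=
          le_add_of_nonneg_right (by positivity)
        _ = _ := by rw [hB]; ring
    · have hHeq : histSegment r y s = histSegment r x s :=
        histSegment_congr fun u hu => hy_eq u (by linarith [hu.1])
      have hgq : g s = q s := by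
        rw [hg_apply, hHeq, hχ'0 _ (by linarith), hχ1 _ (by linarith)]
        simp
      have hH : ‖histSegment r y s‖ ≤ S * (Real.exp (β * r) * Real.exp (-β * (s - a))) := by
        refine norm_histSegment_le (by positivity) fun u hu => ?_
        refine (key u ⟨by linarith [hu.1], hu.2.trans hs.2⟩).trans ?_
        rw [← Real.exp_add]
        gcongr
        nlinarith [hu.1]
      rw [hgq]
      calc ‖q s‖ ≤ ε * ‖histSegment r y s‖ := by rw [hHeq]; exact hq s hs
        _ ≤ ε * (S * (Real.exp (β * r) * Real.exp (-β * (s - a)))) := by gcongr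
        _ ≤ A * D * Real.exp (β * (2 * r)) * Real.exp (-β * (s - a)) +
            ε * (S * (Real.exp (β * r) * Real.exp (-β * (s - a)))) :=
          le_add_of_nonneg_left (by positivity)
        _ = _ := by rw [hB]; ring
  have hSB : S ≤ M₀ * B / (α - β) := by
    have h1 : ‖y p‖ ≤ M₀ * B / (α - β) * Real.exp (-β * (p - a)) := by
      rw [hrep p hp]
      exact norm_causalConvolution_le hX (by linarith) (by positivity) (by linarith) hdecay hp.1
        fun s hs => hg s ⟨hs.1, hs.2.trans hp.2⟩
    calc S ≤ Real.exp (β * (p - a)) * (M₀ * B / (α - β) * Real.exp (-β * (p - a))) := by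
          rw [hS]; gcongr
      _ = M₀ * B / (α - β) * Real.exp (β * (p - a) + -β * (p - a)) := by
          rw [Real.exp_add]; ring
      _ = _ := by simp
  have hSfinal : S ≤ 4 * M₀ * (A * Real.exp (β * (2 * r))) / α * D := by
    have h1 : M₀ * B / (α - β) =
        2 * M₀ * (A * Real.exp (β * (2 * r))) / α * D + S / 4 := by
      have h2 : α - β = α / 2 := by rw [hβ]; ring
      have h3 : M₀ ≠ 0 := by positivity
      rw [h2, hB, hε]
      field_simp
      ring
    have h4 : 4 * M₀ * (A * Real.exp (β * (2 * r))) / α * D =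
      2 * (2 * M₀ * (A * Real.exp (β * (2 * r))) / α * D) := by ring
    rw [h4]
    linarith
  rw [← hy_eq t₁ ht₁.1]
  refine (key t₁ ⟨by linarith [ht₁.1], ht₁.2⟩).trans ?_
  gcongr

end VariationOfConstants

section Existence

/-- Tonelli's delayed integral operator for the equation `v' = F (t, (ψ + v)_t)`, `v b = 0`. -/
noncomputable def tonelliOperator {F : ℝ × C(Icc (-r) (0 : ℝ), E) → E} (hF : Continuous F)
    (ψ : C(ℝ, E)) (b η : ℝ) (v : C(ℝ, E)) : C(ℝ, E) where
  toFun t := ∫ s in b..max (t - η) b, F (s, histSegment r (ψ + v) s)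
  continuous_toFun := by
    have h1 := continuous_histSegment (r := r) (ψ + v)
    have h2 : Continuous fun s => F (s, histSegment r (ψ + v) s) := by fun_prop
    exact (intervalIntegral.continuous_primitive (fun _ _ => h2.intervalIntegrable _ _) b).comp
      (by fun_prop)

variable {F : ℝ × C(Icc (-r) (0 : ℝ), E) → E}

lemma tonelliOperator_apply (hF : Continuous F) (ψ : C(ℝ, E)) (b η : ℝ) (v : C(ℝ, E)) (t : ℝ) :
    tonelliOperator hF ψ b η v t =
      ∫ s in b..max (t - η) b, F (s, histSegment r (ψ + v) s) := rfl

lemma iterate_tonelliOperator_succ_eq (hF : Continuous F) (ψ : C(ℝ, E)) {b η : ℝ} (hη : 0 ≤ η)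
    (j : ℕ) : ∀ t ≤ b + j * η,
      (tonelliOperator hF ψ b η)^[j + 1] 0 t = (tonelliOperator hF ψ b η)^[j] 0 t := by
  induction j with
  | zero =>
    intro t ht
    have : t - η ≤ b := by simp at ht; linarith
    simp [tonelliOperator_apply, this]
  | succ j ih =>
    intro t ht
    rw [Function.iterate_succ_apply', Function.iterate_succ_apply' _ j, tonelliOperator_apply,
      tonelliOperator_apply]
    refine intervalIntegral.integral_congr fun s hs => ?_
    rw [uIcc_of_le (le_max_right _ _)] at hs
    have hs2 : s ≤ b + j * η := by
      refine hs.2.trans (max_le ?_ (by nlinarith [Nat.cast_nonneg (α := ℝ) j]))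
      push_cast at ht
      linarith
    have : histSegment r (ψ + (tonelliOperator hF ψ b η)^[j + 1] 0) s =
        histSegment r (ψ + (tonelliOperator hF ψ b η)^[j] 0) s :=
      histSegment_congr fun u hu => by
        simp only [ContinuousMap.add_apply]
        rw [ih u (hu.2.trans hs2)]
    rw [Function.iterate_succ_apply'] at this
    exact congrArg (fun c => F (s, c)) this

/-- Peano existence theorem for delay equations with bounded continuous right-hand side, in
integral form. -/
lemma exists_delay_integral_solution [ProperSpace E] (hF : Continuous F) {K : ℝ} (hK : ∀ p, ‖F p‖ ≤ K)
    (ψ : C(ℝ, E)) (b : ℝ) : ∃ v : C(ℝ, E), (∀ t ≤ b, v t = 0) ∧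
      ∀ t ∈ Icc b (b + 1), v t = ∫ s in b..t, F (s, histSegment r (ψ + v) s) := by
  have hFc : ∀ v : C(ℝ, E), Continuous fun s => F (s, histSegment r (ψ + v) s) := fun v => by
    have h1 := continuous_histSegment (r := r) (ψ + v)
    fun_prop
  have hK0 : 0 ≤ K := (norm_nonneg _).trans (hK 0)
  have hdiff : ∀ (v : C(ℝ, E)) (p q : ℝ), ‖(∫ s in b..p, F (s, histSegment r (ψ + v) s)) -
      ∫ s in b..q, F (s, histSegment r (ψ + v) s)‖ ≤ K * |p - q| := fun v p q => by
    rw [intervalIntegral.integral_interval_sub_left ((hFc v).intervalIntegrable _ _)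
      ((hFc v).intervalIntegrable _ _)]
    exact intervalIntegral.norm_integral_le_of_norm_le_const fun s _ => hK _
  let η : ℕ → ℝ := fun k => 1 / ((k : ℝ) + 1)
  have hη : ∀ k, 0 < η k := fun k => by positivity
  let v : ℕ → C(ℝ, E) := fun k => (tonelliOperator hF ψ b (η k))^[k + 1] 0
  have hmem : ∀ k, v k ∈
      {v : C(ℝ, E) | (∀ t ≤ b, v t = 0) ∧ ∀ s t, ‖v s - v t‖ ≤ K * |s - t|} := by
    intro k
    simp only [v, Function.iterate_succ_apply']
    refine ⟨fun t ht => ?_, fun s t => ?_⟩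
    · rw [tonelliOperator_apply, max_eq_right (by linarith [hη k]), intervalIntegral.integral_same]
    · rw [tonelliOperator_apply, tonelliOperator_apply]
      refine (hdiff _ _ _).trans (mul_le_mul_of_nonneg_left ?_ hK0)
      simpa using abs_max_sub_max_le_abs (s - η k) (t - η k) b
  have hfix : ∀ k, ∀ t ≤ b + 1,
      v k t = ∫ s in b..max (t - η k) b, F (s, histSegment r (ψ + v k) s) := by
    intro k t ht
    have h1 := iterate_tonelliOperator_succ_eq hF ψ (b := b) (hη k).le (k + 1) t (by
      have : ((k + 1 : ℕ) : ℝ) * η k = 1 := by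
        simp only [η]; push_cast; field_simp
      rw [this]; exact ht)
    rw [Function.iterate_succ_apply', tonelliOperator_apply] at h1
    exact h1.symm
  obtain ⟨w, hw, κ, hκ, hlim⟩ := (isCompact_setOf_lipschitz_eq_zero b K).tendsto_subseq hmem
  refine ⟨w, hw.1, fun t ht => ?_⟩
  have hev : Tendsto (fun k => v (κ k) t) atTop (𝓝 (w t)) :=
    ((continuous_eval_const (F := C(ℝ, E)) t).tendsto w).comp hlim
  have hintegral : Tendsto (fun k => ∫ s in b..t, F (s, histSegment r (ψ + v (κ k)) s)) atTop
      (𝓝 (∫ s in b..t, F (s, histSegment r (ψ + w) s))) := by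
    refine intervalIntegral.tendsto_integral_filter_of_dominated_convergence (fun _ => K)
      (Eventually.of_forall fun k => (hFc _).aestronglyMeasurable)
      (Eventually.of_forall fun k => ae_of_all _ fun s _ => hK _)
      intervalIntegrable_const (ae_of_all _ fun s _ => ?_)
    have hc : Continuous fun u : C(ℝ, E) => F (s, histSegment r (ψ + u) s) := by
      refine hF.comp (continuous_const.prodMk ?_)
      exact continuous_histSegment_uncurry.comp
        ((continuous_const.add continuous_id).prodMk continuous_const)
    exact (hc.tendsto w).comp hlim
  have herr : Tendsto (fun k => v (κ k) t - ∫ s in b..t, F (s, histSegment r (ψ + v (κ k)) s))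
      atTop (𝓝 0) := by
    have hη0 : Tendsto (fun k => K * η (κ k)) atTop (𝓝 0) := by
      have := (tendsto_one_div_add_atTop_nhds_zero_nat (𝕜 := ℝ)).comp hκ.tendsto_atTop
      simpa [η] using this.const_mul K
    refine squeeze_zero_norm (fun k => ?_) hη0
    rw [hfix _ t ht.2]
    refine (hdiff _ _ _).trans (mul_le_mul_of_nonneg_left ?_ hK0)
    have h1 := abs_max_sub_max_le_abs (t - η (κ k)) t b
    rw [max_eq_left ht.1] at h1
    refine h1.trans (le_of_eq ?_)
    rw [sub_sub_cancel_left, abs_neg, abs_of_pos (hη _)]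
  exact sub_eq_zero.1 (tendsto_nhds_unique (hev.sub hintegral) herr)

end Existence

/-- A continuous retraction onto the closed ball of radius `δ`. -/
noncomputable def ballRetraction (δ : ℝ) (v : E) : E := (δ / max δ ‖v‖) • v

lemma continuous_ballRetraction {δ : ℝ} (hδ : 0 < δ) :
    Continuous (ballRetraction δ : E → E) := by
  refine Continuous.smul (Continuous.div continuous_const (by fun_prop) fun v => ?_) continuous_id
  exact (hδ.trans_le (le_max_left _ _)).ne'

lemma norm_ballRetraction_le {δ : ℝ} (hδ : 0 < δ) (v : E) : ‖ballRetraction δ v‖ ≤ δ := by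
  have h : 0 < max δ ‖v‖ := hδ.trans_le (le_max_left _ _)
  rw [ballRetraction, norm_smul, Real.norm_of_nonneg (by positivity), div_mul_eq_mul_div,
    div_le_iff₀ h]
  gcongr
  exact le_max_right _ _

lemma ballRetraction_of_norm_le {δ : ℝ} (hδ : 0 < δ) {v : E} (hv : ‖v‖ ≤ δ) :
    ballRetraction δ v = v := by
  rw [ballRetraction, max_eq_left hv, div_self hδ.ne', one_smul]

section Continuation

variable {n : ℕ} {U₀ : Set C(Icc (-r) (0 : ℝ), Fin n → ℝ)}
  {F : ℝ × C(Icc (-r) (0 : ℝ), Fin n → ℝ) → (Fin n → ℝ)}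

/-- A function that is continuous on `[c, t₀]` and Lipschitz on `[t₀, b)` agrees on `[c, b)` with
a continuous function on the line that is constant on `[b, ∞)`. -/
lemma exists_continuous_extension {x : ℝ → Fin n → ℝ} {c t₀ b : ℝ} {K : NNReal} (hc : c ≤ t₀)
    (hb : t₀ < b) (hx : ContinuousOn x (Icc c t₀)) (hlip : LipschitzOnWith K x (Ico t₀ b)) :
    ∃ y : C(ℝ, Fin n → ℝ), (∀ t ∈ Ico c b, y t = x t) ∧ ∀ t, b ≤ t → y t = y b := by
  obtain ⟨g, hg, hgx⟩ := hlip.extend_pi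
  have hx' : Continuous fun t => x (projIcc c t₀ hc t) :=
    hx.comp_continuous (by fun_prop) fun t => (projIcc c t₀ hc t).2
  have hgc := hg.continuous
  have hgt₀ : g t₀ = x t₀ := (hgx ⟨le_rfl, hb⟩).symm
  refine ⟨⟨fun t => x (projIcc c t₀ hc t) + (g (min (max t t₀) b) - x t₀),
      hx'.add ((hgc.comp (by fun_prop)).sub continuous_const)⟩,
    fun t ht => ?_, fun t ht => ?_⟩
  · simp only [ContinuousMap.coe_mk]
    rcases le_total t t₀ with h | h
    · rw [projIcc_of_mem hc ⟨ht.1, h⟩, max_eq_right h, min_eq_left hb.le, hgt₀]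
      simp
    · rw [projIcc_of_right_le hc h, max_eq_left h, min_eq_left ht.2.le, ← hgx ⟨h, ht.2⟩]
      simp
  · simp only [ContinuousMap.coe_mk]
    rw [projIcc_of_right_le hc (hb.le.trans ht), projIcc_of_right_le hc hb.le,
      max_eq_left (hb.le.trans ht), max_eq_left hb.le, min_eq_right ht, min_self]

/-- A solution on a bounded interval that stays in a ball around `0` on which the right-hand side
is defined and bounded can be continued. -/
lemma IsSolOn.exists_continuation (hr : 0 < r) (hF : ContinuousOn F (univ ×ˢ U₀))
    {t₀ b m δ K : ℝ} (hmδ : m < δ) (hδU : Metric.closedBall 0 δ ⊆ U₀)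
    (hK : ∀ t, t₀ ≤ t → t ≤ b + 1 → ∀ χ : C(Icc (-r) (0 : ℝ), Fin n → ℝ),
      ‖χ‖ ≤ δ → ‖F (t, χ)‖ ≤ K)
    {φ : C(Icc (-r) (0 : ℝ), Fin n → ℝ)} {x : ℝ → Fin n → ℝ} (hx : IsSolOn r U₀ F t₀ b φ x)
    (hxm : ∀ t ∈ Ico (t₀ - r) b, ‖x t‖ ≤ m) :
    ∃ (b' : EReal) (x' : ℝ → Fin n → ℝ), (b : EReal) < b' ∧ IsSolOn r U₀ F t₀ b' φ x' ∧
      ∀ t : ℝ, t₀ - r ≤ t → (t : EReal) < b → x' t = x t := by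
  obtain ⟨hb, hhist, hcont, hsol⟩ := hx
  rw [EReal.coe_lt_coe_iff] at hb
  have hm0 : 0 ≤ m := (norm_nonneg _).trans (hxm t₀ ⟨by linarith, hb⟩)
  have hδ : 0 < δ := hm0.trans_lt hmδ
  have hK0 : 0 ≤ K := (norm_nonneg _).trans (hK t₀ le_rfl (by linarith) 0 (by simpa using hδ.le))
  choose! χ hχx hχU hχd using hsol
  have hχm : ∀ t ∈ Ico t₀ b, ‖χ t‖ ≤ m := fun t ht =>
    (ContinuousMap.norm_le _ hm0).2 fun θ => by
      rw [hχx t ht.1 (EReal.coe_lt_coe ht.2)]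
      exact hxm _ ⟨by linarith [θ.2.1, ht.1], by linarith [θ.2.2, ht.2]⟩
  have hlip : LipschitzOnWith K.toNNReal x (Ico t₀ b) := by
    refine (convex_Ico t₀ b).lipschitzOnWith_of_nnnorm_hasDerivWithin_le
      (f' := fun t => F (t, χ t))
      (fun t ht => (hχd t ht.1 (EReal.coe_lt_coe ht.2)).mono Ico_subset_Ici_self) fun t ht => ?_
    rw [← NNReal.coe_le_coe, coe_nnnorm, Real.coe_toNNReal _ hK0]
    exact hK t ht.1 (by linarith [ht.2]) _ ((hχm t ht).trans hmδ.le)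
  obtain ⟨y, hyx, hyb⟩ := exists_continuous_extension (c := t₀ - r) (by linarith) hb
    (hcont.mono fun t ht => ⟨ht.1, EReal.coe_lt_coe (ht.2.trans_lt hb)⟩) hlip
  let Fb : ℝ × C(Icc (-r) (0 : ℝ), Fin n → ℝ) → (Fin n → ℝ) := fun p =>
    F (projIcc t₀ (b + 1) (by linarith) p.1, ballRetraction δ p.2)
  have hRU : ∀ c : C(Icc (-r) (0 : ℝ), Fin n → ℝ), ballRetraction δ c ∈ U₀ := fun c =>
    hδU (by simpa using norm_ballRetraction_le hδ c)
  have hFb : Continuous Fb := by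
    have h1 := continuous_ballRetraction (E := C(Icc (-r) (0 : ℝ), Fin n → ℝ)) hδ
    exact hF.comp_continuous (by fun_prop) fun p => ⟨mem_univ _, hRU _⟩
  have hFb_bound : ∀ p, ‖Fb p‖ ≤ K := fun p =>
    hK _ (projIcc t₀ (b + 1) _ p.1).2.1 (projIcc t₀ (b + 1) _ p.1).2.2 _
      (norm_ballRetraction_le hδ _)
  have hFb_eq : ∀ t ∈ Icc t₀ (b + 1), ∀ c : C(Icc (-r) (0 : ℝ), Fin n → ℝ), ‖c‖ ≤ δ →
      Fb (t, c) = F (t, c) := fun t ht c hc => by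
    simp only [Fb]
    rw [ballRetraction_of_norm_le hδ hc, projIcc_of_mem _ ht]
  obtain ⟨v, hv0, hv⟩ := exists_delay_integral_solution hFb hFb_bound y b
  set z := y + v with hz
  have hzx : ∀ t ∈ Ico (t₀ - r) b, z t = x t := fun t ht => by
    rw [hz, ContinuousMap.add_apply, hv0 t ht.2.le, add_zero, hyx t ht]
  have hzχ : ∀ t ∈ Ico t₀ b, histSegment r z t = χ t := fun t ht => by
    ext1 θ
    rw [hχx t ht.1 (EReal.coe_lt_coe ht.2), histSegment_apply]
    exact hzx _ ⟨by linarith [θ.2.1, ht.1], by linarith [θ.2.2, ht.2]⟩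
  have hzm : ∀ t ∈ Icc (t₀ - r) b, ‖z t‖ ≤ m := by
    rw [← closure_Ico (show t₀ - r ≠ b by linarith)]
    intro t ht
    exact closure_minimal (t := {t | ‖z t‖ ≤ m}) (fun s hs => by
      change ‖z s‖ ≤ m
      rw [hzx s hs]
      exact hxm s hs)
      (isClosed_le (by fun_prop) continuous_const) ht
  have hHm : ∀ t ∈ Icc t₀ b, ‖histSegment r z t‖ ≤ m := fun t ht =>
    norm_histSegment_le hm0 fun s hs => hzm s ⟨by linarith [hs.1, ht.1], hs.2.trans ht.2⟩
  have hHc : Continuous (histSegment r z) := continuous_histSegment z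
  have hFz : Continuous fun s => Fb (s, histSegment r z s) := by fun_prop
  have hint_left : ∀ t ∈ Icc t₀ b, z t = z t₀ + ∫ s in t₀..t, Fb (s, histSegment r z s) := by
    intro t ht
    rw [intervalIntegral.integral_eq_sub_of_hasDeriv_right z.continuous.continuousOn _
      (hFz.intervalIntegrable _ _)]
    · abel
    · intro s hs
      rw [min_eq_left ht.1, max_eq_right ht.1] at hs
      have hsb : s ∈ Ico t₀ b := ⟨hs.1.le, hs.2.trans_le ht.2⟩
      have hd := (hχd s hsb.1 (EReal.coe_lt_coe hsb.2)).mono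
        (show Ioi s ⊆ Ici t₀ from fun u hu => hsb.1.trans (le_of_lt hu))
      have hval : Fb (s, histSegment r z s) = F (s, χ s) := by
        rw [hzχ s hsb, hFb_eq s ⟨hsb.1, by linarith [hsb.2]⟩ _ ((hχm s hsb).trans hmδ.le)]
      rw [hval]
      refine hd.congr_of_eventuallyEq ?_ (hzx s ⟨by linarith [hsb.1], hsb.2⟩)
      filter_upwards [self_mem_nhdsWithin, nhdsWithin_le_nhds (Iio_mem_nhds hsb.2)] with u hu hub
      exact hzx u ⟨by linarith [hsb.1, mem_Ioi.1 hu], hub⟩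
  have hintegral : ∀ t ∈ Icc t₀ (b + 1), z t = z t₀ + ∫ s in t₀..t, Fb (s, histSegment r z s) := by
    intro t ht
    rcases le_total t b with htb | htb
    · exact hint_left t ⟨ht.1, htb⟩
    · have h1 : z t = z b + v t := by
        rw [hz, ContinuousMap.add_apply, ContinuousMap.add_apply, hv0 b le_rfl, hyb t htb,
          add_zero]
      rw [h1, hint_left b ⟨hb.le, le_rfl⟩, hv t ⟨htb, ht.2⟩, add_assoc,
        intervalIntegral.integral_add_adjacent_intervals (hFz.intervalIntegrable _ _)
          (hFz.intervalIntegrable _ _)]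
  obtain ⟨η, hη, hball⟩ := Metric.isOpen_iff.1
    (isOpen_lt hHc.norm (continuous_const (y := δ))) b
    ((hHm b ⟨hb.le, le_rfl⟩).trans_lt hmδ)
  set b' := b + min η 1 with hb'
  have hη1 : 0 < min η 1 := lt_min hη one_pos
  have hHδ : ∀ t, t₀ ≤ t → t < b' → ‖histSegment r z t‖ ≤ δ := by
    intro t ht htb'
    rcases le_total t b with htb | htb
    · exact (hHm t ⟨ht, htb⟩).trans hmδ.le
    · refine le_of_lt (hball ?_)
      rw [Metric.mem_ball, Real.dist_eq, abs_of_nonneg (by linarith)]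
      linarith [min_le_left η 1]
  refine ⟨b', z, EReal.coe_lt_coe (by linarith), ⟨EReal.coe_lt_coe (by linarith), fun θ => ?_,
    z.continuous.continuousOn, fun t ht htb' => ?_⟩,
    fun t ht htb => hzx t ⟨ht, EReal.coe_lt_coe_iff.1 htb⟩⟩
  · rw [← hhist θ]
    exact hzx _ ⟨by linarith [θ.2.1], by linarith [θ.2.2]⟩
  · rw [EReal.coe_lt_coe_iff] at htb'
    have htb1 : t < b + 1 := by linarith [min_le_right η 1]
    have hHt := hHδ t ht htb'
    refine ⟨histSegment r z t, fun θ => rfl, hδU (by simpa using hHt), ?_⟩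
    rw [← hFb_eq t ⟨ht, htb1.le⟩ _ hHt]
    have hd := ((hFz.integral_hasStrictDerivAt t₀ t).hasDerivAt.const_add
      (z t₀)).hasDerivWithinAt (s := Ici t₀)
    refine hd.congr_of_eventuallyEq ?_ (hintegral t ⟨ht, htb1.le⟩)
    filter_upwards [self_mem_nhdsWithin, nhdsWithin_le_nhds (Iio_mem_nhds htb1)] with u hu hub
    exact hintegral u ⟨hu, le_of_lt hub⟩

end Continuation

section Stability

variable {n : ℕ}

lemma exists_norm_le_of_tendsto_zero {G : Type*} [SeminormedAddCommGroup G] {N : ℝ → G}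
    (hN : Continuous N) (hlim : Tendsto (fun t => ‖N t‖) atTop (𝓝 0)) (σ : ℝ) :
    ∃ B, 0 ≤ B ∧ ∀ t, σ ≤ t → ‖N t‖ ≤ B := by
  obtain ⟨T, hT⟩ := eventually_atTop.1 (hlim.eventually_le_const one_pos)
  obtain ⟨B, hB⟩ := (isCompact_Icc (a := σ) (b := T)).exists_bound_of_continuousOn hN.continuousOn
  refine ⟨max B 1, le_max_of_le_right zero_le_one, fun t ht => ?_⟩
  rcases le_total t T with h | h
  · exact (hB t ⟨ht, h⟩).trans (le_max_left _ _)
  · exact (hT t h).trans (le_max_right _ _)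

/-- The principal fundamental matrix solution, made continuous by freezing it to the left of the
origin, still satisfies the resolvent equation. -/
lemma IsPFMS.resolvent_max {L : C(Icc (-r) (0 : ℝ), Fin n → ℝ) →L[ℝ] (Fin n → ℝ)}
    {X : ℝ → ((Fin n → ℝ) →L[ℝ] (Fin n → ℝ))} (hX : IsPFMS r L X) (ξ : Fin n → ℝ) (t : ℝ)
    (ht : 0 ≤ t) : ∃ ψ : C(Icc (-r) (0 : ℝ), Fin n → ℝ),
      (∀ θ : Icc (-r) (0 : ℝ), ψ θ = ∫ s in (0 : ℝ)..(max (t + (θ : ℝ)) 0), X (max s 0) ξ) ∧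
      X (max t 0) ξ = ξ + L ψ := by
  obtain ⟨ψ, hψ, hXψ⟩ := hX.2.2.2 ξ t ht
  refine ⟨ψ, fun θ => ?_, by rwa [max_eq_left ht]⟩
  rw [hψ]
  refine intervalIntegral.integral_congr fun s hs => ?_
  rw [uIcc_of_le (le_max_right _ _)] at hs
  simp only [max_eq_left hs.1]

/-- A priori exponential bound: as long as a solution stays in a fixed small ball, it decays
exponentially. -/
lemma exists_exponential_bound_of_small (hr : 0 < r) (σ : ℝ)
    {L : C(Icc (-r) (0 : ℝ), Fin n → ℝ) →L[ℝ] (Fin n → ℝ)}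
    {X : ℝ → ((Fin n → ℝ) →L[ℝ] (Fin n → ℝ))} (hX : IsPFMS r L X)
    {M₀ α : ℝ} (hM₀ : 1 ≤ M₀) (hα : 0 < α)
    (hdecay : ∀ t, 0 ≤ t → ‖X t‖ ≤ M₀ * Real.exp (-α * t))
    {U₀ : Set C(Icc (-r) (0 : ℝ), Fin n → ℝ)} (hU₀ : U₀ ∈ 𝓝 0)
    {h : ℝ × C(Icc (-r) (0 : ℝ), Fin n → ℝ) → (Fin n → ℝ)}
    (hcont : ContinuousOn h (univ ×ˢ U₀))
    (hsmall : ∀ ε > (0 : ℝ), ∃ δ > (0 : ℝ),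
      ∀ (t : ℝ) (φ : C(Icc (-r) (0 : ℝ), Fin n → ℝ)),
        φ ∈ U₀ → ‖φ‖ < δ → ‖h (t, φ)‖ ≤ ε * ‖φ‖)
    {N : ℝ → (C(Icc (-r) (0 : ℝ), Fin n → ℝ) →L[ℝ] (Fin n → ℝ))} (hNcont : Continuous N)
    (hNlim : Tendsto (fun t => ‖N t‖) atTop (𝓝 0)) :
    ∃ M : ℝ, 1 ≤ M ∧ ∃ β > 0, ∃ δ > 0, ∃ K : ℝ, Metric.closedBall 0 δ ⊆ U₀ ∧
      (∀ t, σ ≤ t → ∀ χ : C(Icc (-r) (0 : ℝ), Fin n → ℝ), ‖χ‖ ≤ δ →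
        ‖L χ + N t χ + h (t, χ)‖ ≤ K) ∧
      ∀ (t₀ : ℝ) (b : EReal) (φ : C(Icc (-r) (0 : ℝ), Fin n → ℝ)) (x : ℝ → Fin n → ℝ), σ ≤ t₀ →
        IsSolOn r U₀ (fun p => L p.2 + N p.1 p.2 + h p) t₀ b φ x →
        ∀ T : ℝ, t₀ ≤ T → (T : EReal) < b → (∀ s ∈ Icc (t₀ - r) T, ‖x s‖ ≤ δ) →
          ∀ t ∈ Icc (t₀ - r) T, ‖x t‖ ≤ M * Real.exp (-β * (t - t₀)) * ‖φ‖ := by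
  have hXc : Continuous fun t => X (max t 0) :=
    hX.2.1.comp_continuous (by fun_prop) fun t => le_max_right t 0
  obtain ⟨ε, hε, C, hC, hdec⟩ := exists_decay_of_small_perturbation hr hXc hX.resolvent_max hM₀ hα
    (fun t ht => by simpa only [max_eq_left ht] using hdecay t ht)
  obtain ⟨δ₁, hδ₁, hhδ₁⟩ := hsmall (ε / 2) (by positivity)
  obtain ⟨δ₂, hδ₂, hδ₂U⟩ := Metric.nhds_basis_closedBall.mem_iff.1 hU₀
  set δ := min (δ₁ / 2) δ₂ with hδ
  have hδ0 : 0 < δ := by positivity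
  have hδU : Metric.closedBall 0 δ ⊆ U₀ :=
    (Metric.closedBall_subset_closedBall (min_le_right _ _)).trans hδ₂U
  have hh : ∀ t (χ : C(Icc (-r) (0 : ℝ), Fin n → ℝ)), ‖χ‖ ≤ δ → ‖h (t, χ)‖ ≤ ε / 2 * ‖χ‖ :=
    fun t χ hχ => hhδ₁ t χ (hδU (by simpa using hχ))
      (by linarith [min_le_left (δ₁ / 2) δ₂])
  obtain ⟨Nb, hNb0, hNb⟩ := exists_norm_le_of_tendsto_zero (N := N) hNcont hNlim σ
  obtain ⟨TN, hTN⟩ := eventually_atTop.1 (hNlim.eventually_le_const (half_pos hε))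
  set Λ := ‖L‖ + Nb + ε with hΛ
  have hΛ0 : 0 < Λ := by positivity
  set k := max (TN - σ) 0 with hk
  have hk0 : 0 ≤ k := le_max_right _ _
  set D := 2 * Real.exp (2 * Λ * (k + 2 * r)) with hD
  have hD1 : 1 ≤ D := by
    have : 1 ≤ Real.exp (2 * Λ * (k + 2 * r)) := Real.one_le_exp (by positivity)
    linarith
  set β := α / 2 with hβ
  have hβ0 : 0 < β := by positivity
  set M := C * D * Real.exp (β * k) + D * Real.exp (β * (k + 2 * r)) with hM
  have hexp1 : 1 ≤ Real.exp (β * (k + 2 * r)) := Real.one_le_exp (by positivity)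
  have hCD : 0 ≤ C * D * Real.exp (β * k) := by positivity
  refine ⟨M, by nlinarith, β, hβ0, δ, hδ0, Λ * δ, hδU, fun t ht χ hχ => ?_, ?_⟩
  · have h1 : ‖L χ‖ ≤ ‖L‖ * δ := (L.le_opNorm _).trans (by gcongr)
    have h2 : ‖N t χ‖ ≤ Nb * δ := ((N t).le_opNorm _).trans (by gcongr; exact hNb t ht)
    have h3 : ‖h (t, χ)‖ ≤ ε / 2 * δ := (hh t χ hχ).trans (by gcongr)
    have h4 := norm_add₃_le (a := L χ) (b := N t χ) (c := h (t, χ))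
    rw [hΛ]
    nlinarith
  intro t₀ b φ x hσ hx T hT hTb hxδ t₁ ht₁
  obtain ⟨-, hhist, hxcont, hsol⟩ := hx
  have hrT : t₀ - r ≤ T := by linarith
  let y : C(ℝ, Fin n → ℝ) := ⟨fun t => x (projIcc (t₀ - r) T hrT t),
    hxcont.comp_continuous (by fun_prop) fun t => ⟨(projIcc (t₀ - r) T hrT t).2.1,
      (EReal.coe_le_coe (projIcc (t₀ - r) T hrT t).2.2).trans_lt hTb⟩⟩
  have hyx : ∀ t ∈ Icc (t₀ - r) T, y t = x t := fun t ht => by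
    simp only [y, ContinuousMap.coe_mk, projIcc_of_mem hrT ht]
  have hHδ : ∀ t ∈ Icc t₀ T, ‖histSegment r y t‖ ≤ δ := fun t ht =>
    norm_histSegment_le hδ0.le fun s hs => by
      have hs' : s ∈ Icc (t₀ - r) T := ⟨by linarith [hs.1, ht.1], hs.2.trans ht.2⟩
      rw [hyx s hs']
      exact hxδ s hs'
  have hHc := continuous_histSegment (r := r) y
  let q : C(ℝ, Fin n → ℝ) := ⟨fun t =>
    N (projIcc t₀ T hT t) (histSegment r y (projIcc t₀ T hT t)) +
      h (projIcc t₀ T hT t, histSegment r y (projIcc t₀ T hT t)), by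
    refine Continuous.add (by fun_prop) (hcont.comp_continuous (by fun_prop) fun t => ?_)
    exact ⟨mem_univ _, hδU (by simpa using hHδ _ (projIcc t₀ T hT t).2)⟩⟩
  have hq : ∀ t ∈ Icc t₀ T, q t = N t (histSegment r y t) + h (t, histSegment r y t) :=
    fun t ht => by simp only [q, ContinuousMap.coe_mk, projIcc_of_mem hT ht]
  have hq_le : ∀ t ∈ Icc t₀ T, ∀ B, ‖N t‖ ≤ B → ‖q t‖ ≤ (B + ε / 2) * ‖histSegment r y t‖ := by
    intro t ht B hB
    rw [hq t ht, add_mul]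
    refine (norm_add_le _ _).trans (add_le_add ?_ (hh _ _ (hHδ t ht)))
    exact ((N t).le_opNorm _).trans (by gcongr)
  have hder : ∀ t ∈ Ico t₀ T,
      HasDerivWithinAt y (L (histSegment r y t) + q t) (Ici t) t := by
    intro t ht
    obtain ⟨χ, hχ, -, hd⟩ := hsol t ht.1 ((EReal.coe_lt_coe ht.2).trans hTb)
    have hχy : χ = histSegment r y t := by
      ext1 θ
      rw [hχ, histSegment_apply, hyx]
      exact ⟨by linarith [θ.2.1, ht.1], by linarith [θ.2.2, ht.2]⟩
    rw [hq t ⟨ht.1, ht.2.le⟩, ← add_assoc, ← hχy]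
    refine (hd.mono (Ici_subset_Ici.2 ht.1)).congr_of_eventuallyEq ?_
      (hyx t ⟨by linarith [ht.1], ht.2.le⟩)
    filter_upwards [self_mem_nhdsWithin, nhdsWithin_le_nhds (Iio_mem_nhds ht.2)] with u hu huT
    exact hyx u ⟨by linarith [ht.1, mem_Ici.1 hu], le_of_lt huT⟩
  have hyφ : ∀ s ∈ Icc (t₀ - r) t₀, ‖y s‖ ≤ ‖φ‖ := by
    intro s hs
    rw [hyx s ⟨hs.1, hs.2.trans hT⟩]
    have := hhist ⟨s - t₀, by linarith [hs.1], by linarith [hs.2]⟩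
    simp only [add_sub_cancel] at this
    rw [this]
    exact φ.norm_coe_le_norm _
  have hgron := norm_le_of_delay_deriv_bound hr.le (norm_nonneg φ) hΛ0 y.continuous.continuousOn
    hder hyφ fun t ht m hm => by
      have hm0 : 0 ≤ m := (norm_nonneg _).trans (hm t ⟨by linarith, le_rfl⟩)
      have hH := norm_histSegment_le (r := r) hm0 hm
      have h1 : ‖L (histSegment r y t)‖ ≤ ‖L‖ * m := (L.le_opNorm _).trans (by gcongr)
      have h2 : ‖q t‖ ≤ (Nb + ε / 2) * m :=
        (hq_le t ⟨ht.1, ht.2.le⟩ Nb (hNb t (hσ.trans ht.1))).trans (by gcongr)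
      refine (norm_add_le _ _).trans ?_
      rw [hΛ]
      nlinarith
  have hearly : ∀ t ∈ Icc (t₀ - r) T, t ≤ t₀ + k + 2 * r → ‖y t‖ ≤ D * ‖φ‖ := by
    intro t ht htk
    rcases le_total t t₀ with htt | htt
    · exact (hyφ t ⟨ht.1, htt⟩).trans (le_mul_of_one_le_left (norm_nonneg _) hD1)
    · refine (hgron t ⟨htt, ht.2⟩).trans ?_
      rw [hD, mul_right_comm]
      gcongr
      linarith
  rw [← hyx t₁ ht₁, hM, add_mul, add_mul]
  rcases le_total t₁ (t₀ + k + 2 * r) with h₁ | h₁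
  · refine le_add_of_nonneg_of_le (by positivity) ((hearly t₁ ht₁ h₁).trans ?_)
    gcongr
    rw [mul_assoc, ← Real.exp_add]
    refine le_mul_of_one_le_right (by positivity) (Real.one_le_exp ?_)
    nlinarith
  · refine le_add_of_le_of_nonneg ?_ (by positivity)
    have h₂ := hdec y q (t₀ + k) T (D * ‖φ‖) (by positivity)
      (fun t ht => hder t ⟨by linarith [ht.1], ht.2⟩)
      (fun t ht => by
        have htN : TN ≤ t := by
          have := le_max_left (TN - σ) 0
          linarith [ht.1]
        have := hq_le t ⟨by linarith [ht.1], ht.2⟩ _ (hTN t htN)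
        rwa [add_halves] at this)
      (fun t ht htT => hearly t ⟨by linarith [ht.1], htT⟩ ht.2) t₁
      ⟨by linarith, ht₁.2⟩
    refine h₂.trans (le_of_eq ?_)
    have h₃ : -β * (t₁ - (t₀ + k)) = β * k + -β * (t₁ - t₀) := by ring
    rw [h₃, Real.exp_add]
    ring

/-- A bound that improves itself as long as `‖x‖ ≤ δ` shows that `‖x‖ ≤ δ` is never violated. -/
lemma norm_le_of_bootstrap {G : Type*} [SeminormedAddCommGroup G] {x : ℝ → G} {t₀ T δ : ℝ}
    (hx : ContinuousOn x (Icc t₀ T))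
    (hx₀ : ‖x t₀‖ ≤ δ)
    (hboot : ∀ s ∈ Icc t₀ T, (∀ u ∈ Icc t₀ s, ‖x u‖ ≤ δ) → ‖x s‖ < δ) :
    ∀ s ∈ Icc t₀ T, ‖x s‖ ≤ δ := by
  have hcross : ∀ s ∈ Icc t₀ T, δ ≤ ‖x s‖ → ∃ u ∈ Icc t₀ s, ‖x u‖ = δ := fun s hs hδs =>
    intermediate_value_Icc hs.1 (hx.norm.mono (Icc_subset_Icc_right hs.2)) ⟨hx₀, hδs⟩
  intro s hs
  by_contra! hlt
  obtain ⟨u, hu, hxu⟩ := hcross s hs hlt.le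
  have hcomp : IsCompact (Icc t₀ T ∩ (fun t => ‖x t‖) ⁻¹' {δ}) :=
    isCompact_Icc.of_isClosed_subset
      (hx.norm.preimage_isClosed_of_isClosed isClosed_Icc isClosed_singleton) inter_subset_left
  obtain ⟨p, ⟨hp, hpδ⟩, hmin⟩ := hcomp.exists_isLeast ⟨u, ⟨hu.1, hu.2.trans hs.2⟩, hxu⟩
  refine (hboot p hp fun v hv => ?_).ne hpδ
  by_contra! hv'
  have hvT : v ∈ Icc t₀ T := ⟨hv.1, hv.2.trans hp.2⟩
  obtain ⟨w, hw, hxw⟩ := hcross v hvT hv'.le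
  have hpw : p ≤ w := hmin ⟨⟨hw.1, hw.2.trans hvT.2⟩, hxw⟩
  have hvp : v = p := le_antisymm hv.2 (hpw.trans hw.2)
  rw [hvp, show ‖x p‖ = δ from hpδ] at hv'
  exact lt_irrefl _ hv'

end Stability

end Auxiliary

/-- Poincaré–Lyapunov theorem for RFDEs. -/
theorem stmt_17 {n : ℕ} (hn : 0 < n) {r : ℝ} (hr : 0 < r) (σ : ℝ)
    (L : C(Set.Icc (-r) (0:ℝ), Fin n → ℝ) →L[ℝ] (Fin n → ℝ))
    (X : ℝ → ((Fin n → ℝ) →L[ℝ] (Fin n → ℝ))) (hX : IsPFMS r L X)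
    {M₀ α : ℝ} (hM₀ : 1 ≤ M₀) (hα : 0 < α)
    (hdecay : ∀ t, 0 ≤ t → ‖X t‖ ≤ M₀ * Real.exp (-α * t))
    (U₀ : Set C(Set.Icc (-r) (0:ℝ), Fin n → ℝ))
    (hU₀open : IsOpen U₀) (hU₀mem : 0 ∈ U₀)
    (h : ℝ × C(Set.Icc (-r) (0:ℝ), Fin n → ℝ) → (Fin n → ℝ))
    (hcont : ContinuousOn h (Set.univ ×ˢ U₀))
    (hsmall : ∀ ε > (0:ℝ), ∃ δ > (0:ℝ),
      ∀ (t : ℝ) (φ : C(Set.Icc (-r) (0:ℝ), Fin n → ℝ)),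
        φ ∈ U₀ → ‖φ‖ < δ → ‖h (t, φ)‖ ≤ ε * ‖φ‖)
    (N : ℝ → (C(Set.Icc (-r) (0:ℝ), Fin n → ℝ) →L[ℝ] (Fin n → ℝ)))
    (hNcont : Continuous N)
    (hNlim : Filter.Tendsto (fun t => ‖N t‖) Filter.atTop (nhds 0)) :
    ∃ M : ℝ, 1 ≤ M ∧ ∃ β > (0:ℝ), ∃ ρ > (0:ℝ),
      ∀ t₀ : ℝ, σ ≤ t₀ →
        ∀ φ : C(Set.Icc (-r) (0:ℝ), Fin n → ℝ), ‖φ‖ < ρ →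
          ∀ (b : EReal) (x : ℝ → Fin n → ℝ),
            IsNoncontinuableSol r U₀ (fun p => L p.2 + N p.1 p.2 + h p) t₀ b φ x →
            b = ⊤ ∧ ∀ t, t₀ ≤ t → ∀ θ ∈ Set.Icc (-r) (0:ℝ),
              ‖x (t + θ)‖ ≤ M * Real.exp (-β * (t - t₀)) * ‖φ‖ := by
  obtain ⟨M₁, hM₁, β, hβ, δ, hδ, K, hδU, hK, hapriori⟩ := exists_exponential_bound_of_small hr σ hX
    hM₀ hα hdecay (hU₀open.mem_nhds hU₀mem) hcont hsmall hNcont hNlim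
  have hexp : 1 ≤ Real.exp (β * r) := Real.one_le_exp (by positivity)
  have hM : 1 ≤ M₁ * Real.exp (β * r) := by nlinarith
  refine ⟨M₁ * Real.exp (β * r), hM, β, hβ, δ / (2 * (M₁ * Real.exp (β * r))), by positivity, ?_⟩
  intro t₀ ht₀ φ hφ b x hx
  obtain ⟨hsol, hnc⟩ := hx
  have hφM : M₁ * Real.exp (β * r) * ‖φ‖ < δ / 2 := by
    rw [lt_div_iff₀ (by positivity)] at hφ
    linarith
  have hφδ : ‖φ‖ < δ / 2 := (le_mul_of_one_le_left (norm_nonneg _) hM).trans_lt hφM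
  have hexp_le : ∀ t, t₀ - r ≤ t →
      M₁ * Real.exp (-β * (t - t₀)) * ‖φ‖ ≤ M₁ * Real.exp (β * r) * ‖φ‖ := by
    intro t ht
    have : -β * (t - t₀) ≤ β * r := by nlinarith
    gcongr M₁ * Real.exp ?_ * _
  have hxφ : ∀ s ∈ Set.Icc (t₀ - r) t₀, ‖x s‖ ≤ ‖φ‖ := by
    intro s hs
    have hs' := hsol.2.1 ⟨s - t₀, by linarith [hs.1], by linarith [hs.2]⟩
    simp only [add_sub_cancel] at hs'
    rw [hs']
    exact φ.norm_coe_le_norm _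
  have hxδ : ∀ T : ℝ, (T : EReal) < b → ∀ s ∈ Set.Icc (t₀ - r) T, ‖x s‖ ≤ δ := by
    intro T hT s hs
    rcases le_total s t₀ with hst | hst
    · linarith [hxφ s ⟨hs.1, hst⟩]
    refine norm_le_of_bootstrap (t₀ := t₀) (T := T) (hsol.2.2.1.mono fun u hu =>
      ⟨by linarith [hu.1], (EReal.coe_le_coe hu.2).trans_lt hT⟩)
      (by linarith [hxφ t₀ ⟨by linarith, le_rfl⟩]) (fun v hv hle => ?_) s ⟨hst, hs.2⟩
    refine (hapriori t₀ b φ x ht₀ hsol v hv.1 ((EReal.coe_le_coe hv.2).trans_lt hT)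
      (fun u hu => ?_) v ⟨by linarith [hv.1], le_rfl⟩).trans_lt ?_
    · rcases le_total u t₀ with hut | hut
      · linarith [hxφ u ⟨hu.1, hut⟩]
      · exact hle u ⟨hut, hu.2⟩
    · linarith [hexp_le v (by linarith [hv.1])]
  have hbound : ∀ t : ℝ, t₀ - r ≤ t → (t : EReal) < b →
      ‖x t‖ ≤ M₁ * Real.exp (-β * (t - t₀)) * ‖φ‖ := by
    intro t ht htb
    have hmax : ((max t t₀ : ℝ) : EReal) < b := by
      rcases max_choice t t₀ with h' | h' <;> rw [h']
      exacts [htb, hsol.1]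
    exact hapriori t₀ b φ x ht₀ hsol (max t t₀) (le_max_right _ _) hmax (hxδ _ hmax) t
      ⟨ht, le_max_left _ _⟩
  have hb : b = ⊤ := by
    by_contra hb
    lift b to ℝ using ⟨hb, ne_bot_of_gt hsol.1⟩
    have hF : ContinuousOn (fun p : ℝ × C(Set.Icc (-r) (0 : ℝ), Fin n → ℝ) =>
        L p.2 + N p.1 p.2 + h p) (Set.univ ×ˢ U₀) :=
      ContinuousOn.add (by fun_prop) hcont
    obtain ⟨b', x', hbb', hx', heq⟩ := hsol.exists_continuation hr hF (half_lt_self hδ) hδU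
      (fun t ht _ χ hχ => hK t (ht₀.trans ht) χ hχ) fun t ht =>
        (hbound t ht.1 (EReal.coe_lt_coe ht.2)).trans ((hexp_le t ht.1).trans hφM.le)
    exact hnc b' x' hbb' hx' heq
  refine ⟨hb, fun t ht θ hθ => ?_⟩
  refine (hbound (t + θ) (by linarith [hθ.1]) (hb ▸ EReal.coe_lt_top _)).trans ?_
  rw [mul_assoc M₁ (Real.exp _) (Real.exp _), ← Real.exp_add]
  gcongr
  nlinarith [hθ.1]
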